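/- Assume Q = q^2 where q is a power of p, and that p divides N_j for every j ∉ J. For 1 ≤ i ≤ m set r_q(N_i) = ⌊(N_i − 1)/(q + 1)⌋ if q + 1 does not divide N_i − 1, and r_q(N_i) = (N_i − 1)/(q + 1) − 1 otherwise; let R_i^q(J) = { b : ε_j ≤ b_j ≤ N_j − 1 for all j, and b_i ≤ r_q(N_i) }. Let t ≤ n_J be a positive integer and suppose there exists an index i with N(J,t) ⊆ R_i^q(J). Then F(J,t) ⊆ F(J,t)^{⊥_h} (Hermitian duality), dim_{F_{q^2}} F(J,t) = card(N(J,t)), and every nonzero codeword of F(J,t)^{⊥_h} has Hamming weight at least t. -/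

import Mathlib

/-- `ε_j = 1` if `j ∈ J` and `0` otherwise. -/
def eps {m : ℕ} (J : Finset (Fin m)) (j : Fin m) : ℕ := if j ∈ J then 1 else 0

/-- The points `Z_J` of the `J`-affine variety. -/
def ZJ (F : Type) [Field F] [Fintype F] [DecidableEq F] {m : ℕ} (N : Fin m → ℕ)
    (J : Finset (Fin m)) : Finset (Fin m → F) :=
  Finset.univ.filter
    (fun x => ∀ j, (j ∈ J → x j ^ (N j - 1) = 1) ∧ (j ∉ J → x j ^ (N j) = x j))

/-- Evaluation of the monomial `X^b` at all the points of `Z_J`. -/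
def evm (F : Type) [Field F] [Fintype F] [DecidableEq F] {m : ℕ} (N : Fin m → ℕ)
    (J : Finset (Fin m)) (b : Fin m → ℕ) : ↥(ZJ F N J) → F :=
  fun P => ∏ j, P.1 j ^ b j

/-- The set `N(J,t)` of exponent tuples. -/
def NSet {m : ℕ} (N : Fin m → ℕ) (J : Finset (Fin m)) (t : ℕ) : Set (Fin m → ℕ) :=
  { b | (∀ j, eps J j ≤ b j ∧ b j ≤ N j - 1) ∧ ∏ j, (b j + 1 - eps J j) < t }

/-- The code `F(J,t)`: the span of the evaluations of the monomials with exponents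
in `N(J,t)`. -/
noncomputable def Fcode (F : Type) [Field F] [Fintype F] [DecidableEq F] {m : ℕ}
    (N : Fin m → ℕ) (J : Finset (Fin m)) (t : ℕ) : Submodule F (↥(ZJ F N J) → F) :=
  Submodule.span F { v | ∃ b ∈ NSet N J t, v = evm F N J b }

/-- `r_q(N_i) = ⌊(N_i − 1)/(q + 1)⌋` if `q + 1` does not divide `N_i − 1`, and
`(N_i − 1)/(q + 1) − 1` otherwise. -/
def rNq (q n : ℕ) : ℕ := if (q + 1) ∣ (n - 1) then (n - 1) / (q + 1) - 1 else (n - 1) / (q + 1)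

/-- The set `R_i^q(J)` of exponent tuples. -/
def RiqSet (q : ℕ) {m : ℕ} (N : Fin m → ℕ) (J : Finset (Fin m)) (i : Fin m) :
    Set (Fin m → ℕ) :=
  { b | (∀ j, eps J j ≤ b j ∧ b j ≤ N j - 1) ∧ b i ≤ rNq q (N i) }

section RootsOfUnity

variable {F : Type} [Field F] [Fintype F]

theorem exists_isPrimitiveRoot_of_dvd_card_sub_one {n : ℕ} (hn : n ∣ Fintype.card F - 1) :
    ∃ g : F, IsPrimitiveRoot g n := by
  obtain ⟨u, hu⟩ := IsCyclic.exists_ofOrder_eq_natCard (α := Fˣ)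
  have hcard : Nat.card Fˣ = Fintype.card F - 1 := by
    rw [Nat.card_units, Nat.card_eq_fintype_card]
  have hpos : 0 < Fintype.card F - 1 := Nat.sub_pos_of_lt Fintype.one_lt_card
  have hprim : IsPrimitiveRoot (u : F) (Fintype.card F - 1) := by
    rw [IsPrimitiveRoot.coe_units_iff, ← hcard, ← hu]
    exact IsPrimitiveRoot.orderOf u
  obtain ⟨k, hk⟩ := hn
  exact ⟨(u : F) ^ k, hprim.pow hpos (by rw [hk, mul_comm])⟩

variable [DecidableEq F]

theorem card_filter_pow_eq_one {n : ℕ} (hn0 : 0 < n) (hn : n ∣ Fintype.card F - 1) :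
    (Finset.univ.filter (fun x : F => x ^ n = 1)).card = n := by
  obtain ⟨g, hg⟩ := exists_isPrimitiveRoot_of_dvd_card_sub_one hn
  refine Eq.trans ?_ hg.card_nthRootsFinset
  congr 1
  ext x
  simp [Polynomial.mem_nthRootsFinset hn0]

theorem sum_filter_pow_eq_one_pow_eq_zero {n k : ℕ} (hn0 : 0 < n) (hn : n ∣ Fintype.card F - 1)
    (hk : ¬ n ∣ k) :
    ∑ x ∈ Finset.univ.filter (fun x : F => x ^ n = 1), x ^ k = 0 := by
  obtain ⟨g, hg⟩ := exists_isPrimitiveRoot_of_dvd_card_sub_one hn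
  have hg0 : g ≠ 0 := hg.ne_zero hn0.ne'
  have hgk : g ^ k ≠ 1 := fun h => hk (hg.dvd_of_pow_eq_one k h)
  have key : ∑ x ∈ Finset.univ.filter (fun x : F => x ^ n = 1), x ^ k =
      g ^ k * ∑ x ∈ Finset.univ.filter (fun x : F => x ^ n = 1), x ^ k := by
    rw [Finset.mul_sum]
    symm
    refine Finset.sum_bij' (fun x _ => g * x) (fun x _ => g⁻¹ * x) ?_ ?_ ?_ ?_ ?_
    · intro x hx
      simp only [Finset.mem_filter, Finset.mem_univ, true_and] at hx ⊢
      rw [mul_pow, hx, hg.pow_eq_one, one_mul]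
    · intro x hx
      simp only [Finset.mem_filter, Finset.mem_univ, true_and] at hx ⊢
      rw [mul_pow, hx, inv_pow, hg.pow_eq_one, inv_one, one_mul]
    · intro x _
      simp [hg0]
    · intro x _
      simp [hg0]
    · intro x _
      rw [mul_pow]
  have h0 : (1 - g ^ k) * ∑ x ∈ Finset.univ.filter (fun x : F => x ^ n = 1), x ^ k = 0 := by
    linear_combination key
  exact (mul_eq_zero.1 h0).resolve_left (sub_ne_zero.2 hgk.symm)

end RootsOfUnity

/-- The `j`-th coordinate projection of `Z_J`. -/
def ZJCoord (F : Type) [Field F] [Fintype F] [DecidableEq F] {m : ℕ} (N : Fin m → ℕ)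
    (J : Finset (Fin m)) (j : Fin m) : Finset F :=
  Finset.univ.filter (fun x => (j ∈ J → x ^ (N j - 1) = 1) ∧ (j ∉ J → x ^ N j = x))

/-- The exponent tuples `b` with `ε_j ≤ b_j ≤ N_j - 1`. -/
def exponentBox {m : ℕ} (N : Fin m → ℕ) (J : Finset (Fin m)) : Finset (Fin m → ℕ) :=
  Fintype.piFinset (fun j => Finset.Icc (eps J j) (N j - 1))

theorem mem_exponentBox {m : ℕ} {N : Fin m → ℕ} {J : Finset (Fin m)} {b : Fin m → ℕ} :
    b ∈ exponentBox N J ↔ ∀ j, eps J j ≤ b j ∧ b j ≤ N j - 1 := by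
  simp [exponentBox]

theorem eps_le_one {m : ℕ} (J : Finset (Fin m)) (j : Fin m) : eps J j ≤ 1 := by
  unfold eps; split_ifs <;> simp

theorem NSet_subset_exponentBox {m : ℕ} (N : Fin m → ℕ) (J : Finset (Fin m)) (t : ℕ) :
    NSet N J t ⊆ exponentBox N J :=
  fun _ hb => Finset.mem_coe.2 (mem_exponentBox.2 hb.1)

section Variety

variable {F : Type} [Field F] [Fintype F] [DecidableEq F] {m : ℕ} {N : Fin m → ℕ}
  {J : Finset (Fin m)}

theorem ZJ_eq_piFinset : ZJ F N J = Fintype.piFinset (ZJCoord F N J) := by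
  ext x
  simp [ZJ, ZJCoord]

theorem ZJCoord_of_mem {j : Fin m} (hj : j ∈ J) :
    ZJCoord F N J j = Finset.univ.filter (fun x : F => x ^ (N j - 1) = 1) := by
  ext x
  simp [ZJCoord, hj]

theorem ZJCoord_of_notMem {j : Fin m} (hN : 1 < N j) (hj : j ∉ J) :
    ZJCoord F N J j = insert 0 (Finset.univ.filter (fun x : F => x ^ (N j - 1) = 1)) := by
  ext x
  obtain ⟨n, hn⟩ : ∃ n, N j = n + 1 := ⟨N j - 1, by omega⟩
  have hn0 : n ≠ 0 := by omega
  simp only [ZJCoord, hj, Finset.mem_filter, Finset.mem_univ, true_and, Finset.mem_insert, hn,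
    Nat.add_sub_cancel, not_false_eq_true, forall_true_left, false_imp_iff]
  by_cases hx : x = 0
  · simp [hx]
  · simp [hx, pow_succ]

theorem zero_notMem_filter_pow_eq_one {n : ℕ} (hn : n ≠ 0) :
    (0 : F) ∉ Finset.univ.filter (fun x : F => x ^ n = 1) := by
  simp [hn]

theorem card_ZJCoord {j : Fin m} (hN : 1 < N j) (hdvd : (N j - 1) ∣ (Fintype.card F - 1)) :
    (ZJCoord F N J j).card = N j - eps J j := by
  by_cases hj : j ∈ J
  · rw [ZJCoord_of_mem hj, card_filter_pow_eq_one (by omega) hdvd]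
    simp [eps, hj]
  · rw [ZJCoord_of_notMem hN hj, Finset.card_insert_of_notMem
      (zero_notMem_filter_pow_eq_one (by omega)), card_filter_pow_eq_one (by omega) hdvd]
    simp only [eps, hj, if_false]
    omega

theorem sum_pow_ZJCoord_eq_zero (p : ℕ) [CharP F p] {j : Fin m} (hN : 1 < N j)
    (hdvd : (N j - 1) ∣ (Fintype.card F - 1)) (hpN : j ∉ J → p ∣ N j) {k : ℕ}
    (hk : eps J j ≤ k) (hkN : k < N j - 1) : ∑ x ∈ ZJCoord F N J j, x ^ k = 0 := by
  by_cases hk0 : k = 0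
  · have hj : j ∉ J := by
      intro hj
      simp [eps, hj, hk0] at hk
    have hcard := card_ZJCoord (F := F) (J := J) hN hdvd
    simp only [hk0, pow_zero, Finset.sum_const, nsmul_eq_mul, mul_one, hcard, eps, hj, if_false,
      Nat.sub_zero]
    exact (CharP.cast_eq_zero_iff F p _).2 (hpN hj)
  · have hndvd : ¬ (N j - 1) ∣ k := fun h => by
      have := Nat.le_of_dvd (Nat.pos_of_ne_zero hk0) h
      omega
    have hsum := sum_filter_pow_eq_one_pow_eq_zero (F := F) (by omega) hdvd hndvd
    by_cases hj : j ∈ J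
    · rw [ZJCoord_of_mem hj, hsum]
    · rw [ZJCoord_of_notMem hN hj, Finset.sum_insert (zero_notMem_filter_pow_eq_one (by omega)),
        hsum, zero_pow hk0, zero_add]

theorem pow_eq_self_of_mem_ZJCoord {j : Fin m} (hN : 1 < N j) {x : F}
    (hx : x ∈ ZJCoord F N J j) : x ^ N j = x := by
  simp only [ZJCoord, Finset.mem_filter, Finset.mem_univ, true_and] at hx
  by_cases hj : j ∈ J
  · obtain ⟨n, hn⟩ : ∃ n, N j = n + 1 := ⟨N j - 1, by omega⟩
    have h1 := hx.1 hj
    rw [hn, Nat.add_sub_cancel] at h1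
    rw [hn, pow_succ, h1, one_mul]
  · exact hx.2 hj

theorem exists_reduced_exponent {j : Fin m} (hN : 1 < N j) (k : ℕ) (hk : eps J j ≤ k) :
    ∃ k', eps J j ≤ k' ∧ k' ≤ N j - 1 ∧ k' ≤ k ∧ ∀ x ∈ ZJCoord F N J j, x ^ k = x ^ k' := by
  induction k using Nat.strong_induction_on with
  | _ k ih =>
    by_cases hkN : k ≤ N j - 1
    · exact ⟨k, hk, hkN, le_rfl, fun _ _ => rfl⟩
    · have heps := eps_le_one J j
      obtain ⟨k', h1, h2, hle, h3⟩ := ih (k - N j + 1) (by omega) (by omega)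
      refine ⟨k', h1, h2, by omega, fun x hx => ?_⟩
      rw [← h3 x hx]
      conv_lhs => rw [show k = k - N j + N j by omega]
      rw [pow_add, pow_eq_self_of_mem_ZJCoord hN hx, pow_succ]

theorem apply_mem_ZJCoord (P : ↥(ZJ F N J)) (j : Fin m) : P.1 j ∈ ZJCoord F N J j := by
  have h : P.1 ∈ Fintype.piFinset (ZJCoord F N J) := (Finset.ext_iff.1 ZJ_eq_piFinset _).1 P.2
  exact Fintype.mem_piFinset.1 h j

theorem exists_mem_exponentBox_evm_eq (hN : ∀ j, 1 < N j) (b : Fin m → ℕ)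
    (hb : ∀ j, eps J j ≤ b j) :
    ∃ b' ∈ exponentBox N J, b' ≤ b ∧ evm F N J b = evm F N J b' := by
  choose b' h1 h2 hle h3 using fun j => exists_reduced_exponent (F := F) (J := J) (hN j) (b j) (hb j)
  refine ⟨b', mem_exponentBox.2 fun j => ⟨h1 j, h2 j⟩, hle, ?_⟩
  funext P
  exact Finset.prod_congr rfl fun j _ => h3 j _ (apply_mem_ZJCoord P j)

theorem exists_polynomial_separating {j : Fin m} (hN : 1 < N j) {x : F}
    (hx : x ∈ ZJCoord F N J j) :
    ∃ f : Polynomial F, (∀ k < eps J j, f.coeff k = 0) ∧ f.eval x ≠ 0 ∧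
      ∀ y, y ≠ x → f.eval y = 0 := by
  have hc : Fintype.card F - 1 ≠ 0 := (Nat.sub_pos_of_lt Fintype.one_lt_card).ne'
  have heval : ∀ y, y ≠ x → 1 - (y - x) ^ (Fintype.card F - 1) = 0 := fun y hy => by
    rw [FiniteField.pow_card_sub_one_eq_one _ (sub_ne_zero.2 hy), sub_self]
  refine ⟨Polynomial.X ^ eps J j *
    (1 - (Polynomial.X - Polynomial.C x) ^ (Fintype.card F - 1)), ?_, ?_, ?_⟩
  · intro k hk
    rw [Polynomial.coeff_X_pow_mul', if_neg (by omega)]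
  · simp only [Polynomial.eval_mul, Polynomial.eval_pow, Polynomial.eval_X, Polynomial.eval_sub,
      Polynomial.eval_one, Polynomial.eval_C, sub_self, zero_pow hc, sub_zero, mul_one]
    by_cases hj : j ∈ J
    · have h0 : x ≠ 0 := by
        rintro rfl
        rw [ZJCoord_of_mem hj] at hx
        exact zero_notMem_filter_pow_eq_one (by omega) hx
      exact pow_ne_zero _ h0
    · simp [eps, hj]
  · intro y hy
    simp [heval y hy]

theorem single_mem_span_evm (hN : ∀ j, 1 < N j) (P : ↥(ZJ F N J)) :
    Pi.single P 1 ∈ Submodule.span F (evm F N J '' (exponentBox N J : Set (Fin m → ℕ))) := by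
  choose f hf0 hfP hfQ using
    fun j => exists_polynomial_separating (hN j) (apply_mem_ZJCoord P j)
  set g : ↥(ZJ F N J) → F := fun R => ∏ j, (f j).eval (R.1 j) with hg
  have hgP : g P ≠ 0 := Finset.prod_ne_zero_iff.2 fun j _ => hfP j
  have hgsingle : Pi.single P 1 = (g P)⁻¹ • g := by
    funext R
    by_cases hR : R = P
    · subst hR
      simp [hgP]
    · obtain ⟨j, hj⟩ : ∃ j, R.1 j ≠ P.1 j := by
        by_contra! h
        exact hR (Subtype.ext (funext h))
      have : g R = 0 := Finset.prod_eq_zero (Finset.mem_univ j) (hfQ j _ hj)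
      simp [hR, this]
  have hgsum : g = ∑ b ∈ Fintype.piFinset (fun j => Finset.range ((f j).natDegree + 1)),
      (∏ j, (f j).coeff (b j)) • evm F N J b := by
    funext R
    simp only [hg, Polynomial.eval_eq_sum_range, Finset.prod_univ_sum, Finset.sum_apply,
      Pi.smul_apply, smul_eq_mul, evm, Finset.prod_mul_distrib]
  rw [hgsingle, hgsum]
  refine Submodule.smul_mem _ _ (Submodule.sum_mem _ fun b _ => ?_)
  by_cases hb : ∀ j, eps J j ≤ b j
  · obtain ⟨b', hb', -, h⟩ := exists_mem_exponentBox_evm_eq (F := F) hN b hb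
    rw [h]
    exact Submodule.smul_mem _ _ (Submodule.subset_span ⟨b', hb', rfl⟩)
  · push Not at hb
    obtain ⟨j, hj⟩ := hb
    rw [Finset.prod_eq_zero (Finset.mem_univ j) (hf0 j _ hj), zero_smul]
    exact Submodule.zero_mem _

theorem span_evm_exponentBox (hN : ∀ j, 1 < N j) :
    Submodule.span F (evm F N J '' (exponentBox N J : Set (Fin m → ℕ))) = ⊤ := by
  refine eq_top_iff.2 fun f _ => ?_
  rw [pi_eq_sum_univ' f]
  refine Submodule.sum_mem _ fun P _ => Submodule.smul_mem _ _ ?_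
  convert single_mem_span_evm hN P using 1

theorem card_ZJ (hN : ∀ j, 1 < N j) (hdvd : ∀ j, (N j - 1) ∣ (Fintype.card F - 1)) :
    (ZJ F N J).card = ∏ j, (N j - eps J j) := by
  rw [ZJ_eq_piFinset, Fintype.card_piFinset]
  exact Finset.prod_congr rfl fun j _ => card_ZJCoord (hN j) (hdvd j)

theorem card_exponentBox (hN : ∀ j, 1 < N j) :
    (exponentBox N J).card = ∏ j, (N j - eps J j) := by
  rw [exponentBox, Fintype.card_piFinset]
  refine Finset.prod_congr rfl fun j _ => ?_
  have := hN j
  have := eps_le_one J j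
  rw [Nat.card_Icc]
  omega

theorem linearIndependent_evm_exponentBox (hN : ∀ j, 1 < N j)
    (hdvd : ∀ j, (N j - 1) ∣ (Fintype.card F - 1)) :
    LinearIndependent F (fun b : exponentBox N J => evm F N J b.1) := by
  refine linearIndependent_of_top_le_span_of_card_eq_finrank ?_ ?_
  · rw [← span_evm_exponentBox hN, Set.image_eq_range]
    exact le_rfl
  · rw [Module.finrank_fintype_fun_eq_card, Fintype.card_coe, Fintype.card_coe, card_ZJ hN hdvd,
      card_exponentBox hN]

theorem finrank_Fcode (hN : ∀ j, 1 < N j) (hdvd : ∀ j, (N j - 1) ∣ (Fintype.card F - 1))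
    (t : ℕ) : Module.finrank F (Fcode F N J t) = Nat.card (NSet N J t) := by
  have hfin : Finite (NSet N J t) :=
    (Finset.finite_toSet (exponentBox N J)).subset (NSet_subset_exponentBox N J t)
  have := Fintype.ofFinite (NSet N J t)
  have hli : LinearIndependent F (fun b : NSet N J t => evm F N J b.1) :=
    (linearIndependent_evm_exponentBox hN hdvd).comp
      (Set.inclusion (NSet_subset_exponentBox N J t)) (Set.inclusion_injective _)
  have hspan : Fcode F N J t = Submodule.span F (Set.range fun b : NSet N J t => evm F N J b.1) := by
    unfold Fcode
    congr 1
    ext v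
    simp [eq_comm]
  rw [hspan, finrank_span_eq_card hli, Nat.card_eq_fintype_card]

theorem evm_add (a b : Fin m → ℕ) : evm F N J (a + b) = evm F N J a * evm F N J b := by
  funext P
  simp [evm, pow_add, Finset.prod_mul_distrib]

theorem exists_sum_evm_mul_ne_zero (hN : ∀ j, 1 < N j) {z : ↥(ZJ F N J) → F} (hz : z ≠ 0) :
    ∃ b ∈ exponentBox N J, ∑ P, evm F N J b P * z P ≠ 0 := by
  by_contra! h
  have hall : ∀ f ∈ Submodule.span F (evm F N J '' (exponentBox N J : Set (Fin m → ℕ))),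
      ∑ P, f P * z P = 0 := by
    intro f hf
    induction hf using Submodule.span_induction with
    | mem f hf =>
      obtain ⟨b, hb, rfl⟩ := hf
      exact h b hb
    | zero => simp
    | add f g _ _ hf hg => simp only [Pi.add_apply, add_mul, Finset.sum_add_distrib, hf, hg, add_zero]
    | smul a f _ hf => simp only [Pi.smul_apply, smul_eq_mul, mul_assoc, ← Finset.mul_sum, hf, mul_zero]
  rw [span_evm_exponentBox hN] at hall
  refine hz (funext fun P => ?_)
  simpa [Pi.single_apply] using hall (Pi.single P 1) Submodule.mem_top

/-- If `b` is the lexicographically first exponent tuple whose evaluation is not orthogonal to `z`,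
then `z` has weight at least `∏ (b_j + 1 - ε_j)`. -/
theorem prod_le_card_support_of_lex_minimal {z : ↥(ZJ F N J) → F} {b : Fin m → ℕ}
    (hb : ∀ j, eps J j ≤ b j) (hne : ∑ P, evm F N J b P * z P ≠ 0)
    (hmin : ∀ b', (∀ j, eps J j ≤ b' j) → toLex b' < toLex b →
      ∑ P, evm F N J b' P * z P = 0) :
    ∏ j, (b j + 1 - eps J j) ≤ (Finset.univ.filter (fun P => z P ≠ 0)).card := by
  let U := Fintype.piFinset (fun j => Finset.range (b j + 1 - eps J j))
  let w : U → (↥(Finset.univ.filter (fun P => z P ≠ 0)) → F) :=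
    fun u P => evm F N J u.1 P.1 * z P.1
  have hli : LinearIndependent F w := by
    rw [Fintype.linearIndependent_iff]
    intro l hl
    by_contra! hex
    have hne' : (Finset.univ.filter (fun u => l u ≠ 0)).Nonempty := by
      obtain ⟨u, hu⟩ := hex
      exact ⟨u, by simpa using hu⟩
    obtain ⟨v, hv, hvmax⟩ := Finset.exists_max_image _ (fun u : U => toLex u.1) hne'
    simp only [Finset.mem_filter, Finset.mem_univ, true_and] at hv hvmax
    have hrel : ∀ P, ∑ u, l u * (evm F N J u.1 P * z P) = 0 := by
      intro P
      by_cases hP : z P = 0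
      · simp [hP]
      · have h := congrFun hl ⟨P, by simpa using hP⟩
        simpa only [Finset.sum_apply, Pi.smul_apply, smul_eq_mul, Pi.zero_apply] using h
    have hvU : ∀ j, v.1 j < b j + 1 - eps J j := fun j => by
      simpa using Fintype.mem_piFinset.1 v.2 j
    have hvle : ∀ j, v.1 j ≤ b j ∧ eps J j ≤ b j - v.1 j := fun j => by
      have h1 := hvU j
      have h2 := hb j
      omega
    have hvb : v.1 + (b - v.1) = b := by
      funext j
      have := (hvle j).1
      simp only [Pi.add_apply, Pi.sub_apply]
      omega
    have hsum : ∑ u, l u * ∑ P, evm F N J (u.1 + (b - v.1)) P * z P = 0 := by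
      calc ∑ u, l u * ∑ P, evm F N J (u.1 + (b - v.1)) P * z P
          = ∑ P, evm F N J (b - v.1) P * ∑ u, l u * (evm F N J u.1 P * z P) := by
            simp only [Finset.mul_sum]
            rw [Finset.sum_comm]
            refine Finset.sum_congr rfl fun P _ => Finset.sum_congr rfl fun u _ => ?_
            rw [evm_add, Pi.mul_apply]
            ring
        _ = 0 := by simp only [hrel, mul_zero, Finset.sum_const_zero]
    rw [Finset.sum_eq_single v, hvb] at hsum
    · exact (mul_ne_zero hv hne) hsum
    · intro u _ huv
      by_cases hlu : l u = 0
      · rw [hlu, zero_mul]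
      · have hlt : toLex u.1 < toLex v.1 :=
          lt_of_le_of_ne (hvmax u hlu) fun h => huv (Subtype.ext (toLex.injective h))
        rw [hmin, mul_zero]
        · intro j
          have := (hvle j).2
          simp only [Pi.add_apply, Pi.sub_apply]
          omega
        · calc toLex (u.1 + (b - v.1)) = toLex u.1 + toLex (b - v.1) := rfl
            _ < toLex v.1 + toLex (b - v.1) := by gcongr
            _ = toLex b := congrArg toLex hvb
    · simp
  have hcard := hli.fintype_card_le_finrank
  rw [Module.finrank_fintype_fun_eq_card, Fintype.card_coe, Fintype.card_coe,
    Fintype.card_piFinset] at hcard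
  simpa using hcard

/-- A nonzero word orthogonal to all the generators of `F(J,t)` has weight at least `t`. -/
theorem le_card_support_of_forall_NSet (hN : ∀ j, 1 < N j) {t : ℕ} {z : ↥(ZJ F N J) → F}
    (hz : z ≠ 0) (hdual : ∀ b ∈ NSet N J t, ∑ P, evm F N J b P * z P = 0) :
    t ≤ (Finset.univ.filter (fun P => z P ≠ 0)).card := by
  let S : Set (Lex (Fin m → ℕ)) :=
    { b | (∀ j, eps J j ≤ ofLex b j) ∧ ∑ P, evm F N J (ofLex b) P * z P ≠ 0 }
  have hS : S.Nonempty := by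
    obtain ⟨b, hb, hne⟩ := exists_sum_evm_mul_ne_zero hN hz
    exact ⟨toLex b, fun j => (mem_exponentBox.1 hb j).1, hne⟩
  obtain ⟨b, ⟨hb, hne⟩, hmin⟩ := WellFounded.has_min (wellFounded_lt (α := Lex (Fin m → ℕ))) S hS
  have hbound := prod_le_card_support_of_lex_minimal (b := ofLex b) hb hne fun b' hb' hlt => by
    by_contra h
    exact hmin (toLex b') ⟨hb', h⟩ hlt
  refine le_trans ?_ hbound
  by_contra! hlt
  obtain ⟨b', hb', hle, heq⟩ := exists_mem_exponentBox_evm_eq (F := F) hN (ofLex b) hb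
  rw [heq] at hne
  refine hne (hdual b' ⟨mem_exponentBox.1 hb', lt_of_le_of_lt ?_ hlt⟩)
  exact Finset.prod_le_prod' fun j _ => Nat.sub_le_sub_right (Nat.succ_le_succ (hle j)) _

theorem sum_evm_mul_evm_pow (a b : Fin m → ℕ) (q : ℕ) :
    ∑ P, evm F N J a P * evm F N J b P ^ q =
      ∏ j, ∑ x ∈ ZJCoord F N J j, x ^ (a j + b j * q) := by
  rw [Finset.prod_univ_sum, ← ZJ_eq_piFinset, ← Finset.sum_coe_sort (ZJ F N J)]
  refine Finset.sum_congr rfl fun P _ => ?_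
  simp only [evm, ← Finset.prod_pow, ← Finset.prod_mul_distrib, pow_add, pow_mul]

theorem rNq_mul_succ_lt {q n : ℕ} (hn : 1 < n) : rNq q n * (q + 1) < n - 1 := by
  unfold rNq
  have hle := Nat.div_mul_le_self (n - 1) (q + 1)
  split_ifs with h
  · rw [Nat.sub_mul, one_mul]
    omega
  · exact lt_of_le_of_ne hle fun heq => h ⟨_, by rw [mul_comm]; exact heq.symm⟩

theorem sum_evm_mul_evm_pow_eq_zero (p : ℕ) [CharP F p] {q : ℕ} {i : Fin m} (hN : 1 < N i)
    (hdvd : (N i - 1) ∣ (Fintype.card F - 1)) (hpN : i ∉ J → p ∣ N i) {a b : Fin m → ℕ}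
    (ha : a ∈ RiqSet q N J i) (hb : b ∈ RiqSet q N J i) :
    ∑ P, evm F N J a P * evm F N J b P ^ q = 0 := by
  rw [sum_evm_mul_evm_pow]
  refine Finset.prod_eq_zero (Finset.mem_univ i) (sum_pow_ZJCoord_eq_zero p hN hdvd hpN ?_ ?_)
  · exact (ha.1 i).1.trans (Nat.le_add_right _ _)
  · calc a i + b i * q ≤ rNq q (N i) + rNq q (N i) * q :=
          Nat.add_le_add ha.2 (Nat.mul_le_mul_right q hb.2)
      _ = rNq q (N i) * (q + 1) := by ring
      _ < N i - 1 := rNq_mul_succ_lt hN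

theorem evm_mem_Fcode {t : ℕ} {b : Fin m → ℕ} (hb : b ∈ NSet N J t) :
    evm F N J b ∈ Fcode F N J t :=
  Submodule.subset_span ⟨b, hb, rfl⟩

end Variety

/-- The form `∑ x_i y_i^(p^e)` vanishes on a span if it vanishes on the generators. -/
theorem sum_mul_pow_eq_zero_of_mem_span {F ι : Type*} [Field F] [Fintype ι] (p e : ℕ)
    [ExpChar F p] {s : Set (ι → F)}
    (hs : ∀ x ∈ s, ∀ y ∈ s, ∑ i, x i * y i ^ p ^ e = 0) {x y : ι → F}
    (hx : x ∈ Submodule.span F s) (hy : y ∈ Submodule.span F s) :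
    ∑ i, x i * y i ^ p ^ e = 0 := by
  have hq : p ^ e ≠ 0 := pow_ne_zero _ (expChar_pos F p).ne'
  induction hx using Submodule.span_induction with
  | mem x hx =>
    induction hy using Submodule.span_induction with
    | mem y hy => exact hs x hx y hy
    | zero => simp only [Pi.zero_apply, zero_pow hq, mul_zero, Finset.sum_const_zero]
    | add y z _ _ hy hz =>
      simp only [Pi.add_apply, add_pow_expChar_pow, mul_add, Finset.sum_add_distrib, hy, hz,
        add_zero]
    | smul a y _ hy =>
      simp only [Pi.smul_apply, smul_eq_mul, mul_pow, mul_left_comm _ (a ^ p ^ e),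
        ← Finset.mul_sum, hy, mul_zero]
  | zero => simp only [Pi.zero_apply, zero_mul, Finset.sum_const_zero]
  | add x z _ _ hx hz =>
    simp only [Pi.add_apply, add_mul, Finset.sum_add_distrib, hx, hz, add_zero]
  | smul a x _ hx =>
    simp only [Pi.smul_apply, smul_eq_mul, mul_assoc, ← Finset.mul_sum, hx, mul_zero]

/-- Theorem 8 of the paper. Over `F_{q^2}`, if `p ∣ N_j` for all
`j ∉ J` and `N(J,t) ⊆ R_i^q(J)` for some `i`, then `F(J,t)` is Hermitian
self-orthogonal, has dimension `card N(J,t)`, and its Hermitian dual has minimum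
distance at least `t`. -/
theorem Fcode_hermitian_self_orthogonal_of_NSet_subset
    (p e m : ℕ) (hp : p.Prime) (he : 0 < e)
    (F : Type) [Field F] [Fintype F] [DecidableEq F]
    (hF : Fintype.card F = (p ^ e) ^ 2)
    (N : Fin m → ℕ) (hN : ∀ j, 1 < N j)
    (hNdvd : ∀ j, (N j - 1) ∣ (Fintype.card F - 1))
    (J : Finset (Fin m)) (hpN : ∀ j ∉ J, p ∣ N j)
    (t : ℕ) (ht : 1 ≤ t) (htn : t ≤ ∏ j, (N j - eps J j))
    (hsub : ∃ i : Fin m, NSet N J t ⊆ RiqSet (p ^ e) N J i) :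
    (∀ x ∈ Fcode F N J t, ∀ y ∈ Fcode F N J t, ∑ i, x i * y i ^ (p ^ e) = 0) ∧
    Module.finrank F (Fcode F N J t) = Nat.card (NSet N J t) ∧
    (∀ y : ↥(ZJ F N J) → F,
      (∀ x ∈ Fcode F N J t, ∑ i, x i * y i ^ (p ^ e) = 0) → y ≠ 0 →
      t ≤ (Finset.univ.filter (fun i => y i ≠ 0)).card) := by
  obtain ⟨i, hi⟩ := hsub
  have : Fact p.Prime := ⟨hp⟩
  have hchar : CharP F p :=
    charP_of_card_eq_prime_pow (f := e * 2) (by rw [hF, pow_mul])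
  have hexp : ExpChar F p := ExpChar.prime hp
  refine ⟨fun x hx y hy => ?_, finrank_Fcode hN hNdvd t, fun y hy hy0 => ?_⟩
  · refine sum_mul_pow_eq_zero_of_mem_span p e ?_ hx hy
    rintro _ ⟨a, ha, rfl⟩ _ ⟨b, hb, rfl⟩
    exact sum_evm_mul_evm_pow_eq_zero p (hN i) (hNdvd i) (hpN i) (hi ha) (hi hb)
  · have hq : p ^ e ≠ 0 := pow_ne_zero _ hp.ne_zero
    have hz0 : (fun P => y P ^ p ^ e) ≠ 0 := fun h =>
      hy0 (funext fun P => eq_zero_of_pow_eq_zero (congrFun h P))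
    have hbound := le_card_support_of_forall_NSet hN hz0 fun b hb => hy _ (evm_mem_Fcode hb)
    simpa only [ne_eq, pow_eq_zero_iff hq] using hbound
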